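/- Let m, n ∈ ℕ, α, β > 0, σ > 1, p > 1, 1/p + 1/q = 1, and f : ℝ₊^m → [0,∞) measurable with 0 < ∫_{ℝ₊^m} ‖x‖_α^{p(m−σ)−m} f(x)^p dx < ∞. Then (∫_{ℝ₊^n} ‖y‖_β^{−pσ−n} (∫_{ℝ₊^m} (coth(‖x‖_α/‖y‖_β) − 1) f(x) dx)^p dy)^{1/p} < K(σ) · (∫_{ℝ₊^m} ‖x‖_α^{p(m−σ)−m} f(x)^p dx)^{1/p}, where K(σ) = [Γ(1/β)^n/(β^{n−1}Γ(n/β))]^{1/p}[Γ(1/α)^m/(α^{m−1}Γ(m/α))]^{1/q}(Γ(σ)/2^{σ−1})ζ(σ). -/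

import Mathlib

open MeasureTheory Real Set

noncomputable def cothR (v : ℝ) : ℝ := (Real.exp v + Real.exp (-v)) / (Real.exp v - Real.exp (-v))
noncomputable def zetaR (σ : ℝ) : ℝ := ∑' k : ℕ+, (k : ℝ) ^ (-σ)
noncomputable def pnorm {s : ℕ} (γ : ℝ) (x : Fin s → ℝ) : ℝ := (∑ i, |x i| ^ γ) ^ (1 / γ)

open scoped ENNReal Pointwise

/-- The open positive orthant of `ℝ^s`. -/
abbrev posOrthant (s : ℕ) : Set (Fin s → ℝ) := {x | ∀ i, 0 < x i}

lemma posOrthant_eq_pi (s : ℕ) : posOrthant s = univ.pi fun _ => Ioi 0 := by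
  ext x; simp

lemma measurableSet_posOrthant (s : ℕ) : MeasurableSet (posOrthant s) := by
  rw [posOrthant_eq_pi]
  exact MeasurableSet.univ_pi fun _ => measurableSet_Ioi

@[fun_prop]
lemma measurable_pnorm {s : ℕ} (γ : ℝ) : Measurable (pnorm γ : (Fin s → ℝ) → ℝ) := by
  unfold pnorm; fun_prop

lemma pnorm_nonneg {s : ℕ} (γ : ℝ) (x : Fin s → ℝ) : 0 ≤ pnorm γ x := by
  unfold pnorm; positivity

lemma pnorm_pos {s : ℕ} (hs : 0 < s) (γ : ℝ) {x : Fin s → ℝ} (hx : x ∈ posOrthant s) :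
    0 < pnorm γ x := by
  have : Nonempty (Fin s) := ⟨⟨0, hs⟩⟩
  exact rpow_pos_of_pos
    (Finset.sum_pos (fun i _ => rpow_pos_of_pos (abs_pos.2 (hx i).ne') _) Finset.univ_nonempty) _

lemma pnorm_rpow {s : ℕ} {γ : ℝ} (hγ : 0 < γ) (x : Fin s → ℝ) :
    pnorm γ x ^ γ = ∑ i, |x i| ^ γ := by
  unfold pnorm
  rw [← rpow_mul (by positivity), one_div_mul_cancel hγ.ne', rpow_one]

lemma abs_apply_le_pnorm {s : ℕ} {γ : ℝ} (hγ : 0 < γ) (x : Fin s → ℝ) (i : Fin s) :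
    |x i| ≤ pnorm γ x := by
  rw [← rpow_le_rpow_iff (abs_nonneg _) (pnorm_nonneg _ _) hγ, pnorm_rpow hγ]
  exact Finset.single_le_sum (f := fun i => |x i| ^ γ) (fun _ _ => by positivity)
    (Finset.mem_univ i)

lemma pnorm_smul {s : ℕ} {γ : ℝ} (hγ : 0 < γ) {r : ℝ} (hr : 0 ≤ r) (x : Fin s → ℝ) :
    pnorm γ (r • x) = r * pnorm γ x := by
  unfold pnorm
  simp only [Pi.smul_apply, smul_eq_mul, abs_mul, abs_of_nonneg hr]
  simp_rw [mul_rpow hr (abs_nonneg _)]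
  rw [← Finset.mul_sum, mul_rpow (by positivity) (by positivity), ← rpow_mul hr,
    mul_one_div_cancel hγ.ne', rpow_one]

/-- The sublevel sets of `pnorm γ` in the positive orthant. -/
abbrev orthantBall (s : ℕ) (γ r : ℝ) : Set (Fin s → ℝ) := posOrthant s ∩ {x | pnorm γ x ≤ r}

lemma orthantBall_eq_smul {s : ℕ} {γ : ℝ} (hγ : 0 < γ) {r : ℝ} (hr : 0 < r) :
    orthantBall s γ r = r • orthantBall s γ 1 := by
  ext x
  rw [mem_smul_set_iff_inv_smul_mem₀ hr.ne']
  simp only [mem_inter_iff, mem_ofPred_eq, pnorm_smul hγ (inv_nonneg.2 hr.le), Pi.smul_apply,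
    smul_eq_mul, inv_mul_le_one₀ hr]
  refine and_congr_left fun _ => forall_congr' fun i => ?_
  rw [mul_pos_iff_of_pos_left (inv_pos.2 hr)]

lemma volume_orthantBall {s : ℕ} {γ : ℝ} (hγ : 0 < γ) {r : ℝ} (hr : 0 < r) :
    volume (orthantBall s γ r) = ENNReal.ofReal (r ^ s) * volume (orthantBall s γ 1) := by
  rw [orthantBall_eq_smul hγ hr, Measure.addHaar_smul, Module.finrank_fin_fun,
    abs_of_pos (by positivity)]

lemma volume_orthantBall_lt_top {s : ℕ} {γ : ℝ} (hγ : 0 < γ) (r : ℝ) :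
    volume (orthantBall s γ r) < ∞ := by
  refine lt_of_le_of_lt (measure_mono (t := univ.pi fun _ => Icc (-r) r) ?_) ?_
  · intro x hx i _
    exact abs_le.1 ((abs_apply_le_pnorm hγ x i).trans hx.2)
  · exact (isCompact_univ_pi fun _ => isCompact_Icc).measure_lt_top

lemma lintegral_Ioc_pow_pred {s : ℕ} (hs : 0 < s) {r : ℝ} (hr : 0 < r) :
    ∫⁻ t in Ioc 0 r, ENNReal.ofReal (s * t ^ (s - 1)) = ENNReal.ofReal (r ^ s) := by
  rw [← ofReal_integral_eq_lintegral_ofReal]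
  · rw [← intervalIntegral.integral_of_le hr.le, intervalIntegral.integral_const_mul, integral_pow]
    obtain ⟨k, rfl⟩ : ∃ k, s = k + 1 := ⟨s - 1, by omega⟩
    have : (k : ℝ) + 1 ≠ 0 := by positivity
    congr 1
    simp only [Nat.add_sub_cancel]
    push_cast
    field_simp
    simp
  · exact (Continuous.integrableOn_Icc (by fun_prop)).mono_set Ioc_subset_Icc_self
  · filter_upwards [ae_restrict_mem measurableSet_Ioc] with t ht
    have := ht.1.le
    simp only [Pi.zero_apply]
    positivity

/-- The distribution of `pnorm γ` under Lebesgue measure on the positive orthant. -/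
lemma map_pnorm_posOrthant {s : ℕ} (hs : 0 < s) {γ : ℝ} (hγ : 0 < γ) :
    (volume.restrict (posOrthant s)).map (pnorm γ) =
      volume (orthantBall s γ 1) •
        (volume.restrict (Ioi 0)).withDensity fun t => ENNReal.ofReal (s * t ^ (s - 1)) := by
  set μ := (volume.restrict (posOrthant s)).map (pnorm γ) with hμ
  set ν := volume (orthantBall s γ 1) •
        (volume.restrict (Ioi 0)).withDensity fun t => ENNReal.ofReal (s * t ^ (s - 1)) with hν
  have hμIic : ∀ r, μ (Iic r) = volume (orthantBall s γ r) := fun r => by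
    rw [hμ, Measure.map_apply (by fun_prop) measurableSet_Iic,
      Measure.restrict_apply (measurable_pnorm γ measurableSet_Iic), inter_comm]
    rfl
  have hfin : ∀ r, μ (Iic r) < ∞ := fun r => by
    rw [hμIic]; exact volume_orthantBall_lt_top hγ r
  have hIic : ∀ r, μ (Iic r) = ν (Iic r) := fun r => by
    rw [hμIic, hν, Measure.smul_apply, withDensity_apply _ measurableSet_Iic,
      Measure.restrict_restrict measurableSet_Iic, inter_comm, Ioi_inter_Iic, smul_eq_mul]
    rcases le_or_gt r 0 with hr | hr
    · have : orthantBall s γ r = ∅ := by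
        ext x
        simp only [mem_inter_iff, mem_empty_iff_false, iff_false, not_and]
        intro hx h
        exact absurd (pnorm_pos hs γ hx) (not_lt.2 (le_trans h hr))
      rw [this, Ioc_eq_empty (not_lt.2 hr)]
      simp
    · rw [lintegral_Ioc_pow_pred hs hr, volume_orthantBall hγ hr, mul_comm]
  have : IsLocallyFiniteMeasure μ := ⟨fun x => ⟨Iic (x + 1), Iic_mem_nhds (by linarith), hfin _⟩⟩
  refine Measure.ext_of_Ioc _ _ fun a b hab => ?_
  rw [← Iic_sdiff_Iic, measure_sdiff (Iic_subset_Iic.2 hab.le) nullMeasurableSet_Iic (hfin a).ne,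
    measure_sdiff (Iic_subset_Iic.2 hab.le) nullMeasurableSet_Iic (by rw [← hIic]; exact (hfin a).ne),
    hIic, hIic]

lemma lintegral_pnorm_eq_volume_mul {s : ℕ} (hs : 0 < s) {γ : ℝ} (hγ : 0 < γ) {φ : ℝ → ℝ≥0∞}
    (hφ : Measurable φ) :
    ∫⁻ x in posOrthant s, φ (pnorm γ x) = volume (orthantBall s γ 1) *
      ∫⁻ t in Ioi 0, ENNReal.ofReal (s * t ^ (s - 1)) * φ t := by
  rw [← lintegral_map hφ (measurable_pnorm γ), map_pnorm_posOrthant hs hγ, lintegral_smul_measure,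
    lintegral_withDensity_eq_lintegral_mul _ (by fun_prop) hφ]
  rfl

lemma integrableOn_exp_neg_rpow {γ : ℝ} (hγ : 0 < γ) :
    IntegrableOn (fun t : ℝ => exp (-t ^ γ)) (Ioi 0) := by
  simpa using integrableOn_rpow_mul_exp_neg_mul_rpow (s := 0) (b := 1) (by norm_num) hγ one_pos

lemma lintegral_exp_neg_pnorm_rpow (s : ℕ) {γ : ℝ} (hγ : 0 < γ) :
    ∫⁻ x in posOrthant s, ENNReal.ofReal (exp (-(pnorm γ x) ^ γ)) =
      ENNReal.ofReal (Gamma (1 / γ + 1) ^ s) := by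
  have heq : ∀ x ∈ posOrthant s, exp (-(pnorm γ x) ^ γ) = ∏ i, exp (-(x i) ^ γ) := by
    intro x hx
    rw [pnorm_rpow hγ, ← exp_sum, Finset.sum_neg_distrib]
    simp_rw [abs_of_pos (hx _)]
  have hmeas : volume.restrict (posOrthant s) =
      Measure.pi fun _ : Fin s => volume.restrict (Ioi (0 : ℝ)) := by
    rw [posOrthant_eq_pi, ← Measure.restrict_pi_pi]; rfl
  rw [setLIntegral_congr_fun (measurableSet_posOrthant s)
    (fun x hx => congrArg ENNReal.ofReal (heq x hx)), hmeas, ← ofReal_integral_eq_lintegral_ofReal]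
  · rw [integral_fintype_prod_eq_pow (fun t : ℝ => exp (-t ^ γ)), integral_exp_neg_rpow hγ,
      Fintype.card_fin]
  · exact Integrable.fintype_prod fun _ => integrableOn_exp_neg_rpow hγ
  · exact Filter.Eventually.of_forall fun x => by simp only [Pi.zero_apply]; positivity

lemma lintegral_pow_mul_exp_neg_rpow {s : ℕ} (hs : 0 < s) {γ : ℝ} (hγ : 0 < γ) :
    ∫⁻ t in Ioi (0 : ℝ), ENNReal.ofReal (s * t ^ (s - 1)) * ENNReal.ofReal (exp (-t ^ γ)) =
      ENNReal.ofReal (s * (1 / γ * Gamma (s / γ))) := by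
  have hs' : (-1 : ℝ) < s - 1 := by
    have : (0 : ℝ) < s := by exact_mod_cast hs
    linarith
  have hcongr : ∀ t ∈ Ioi (0 : ℝ),
      ENNReal.ofReal (s * t ^ (s - 1)) * ENNReal.ofReal (exp (-t ^ γ)) =
        ENNReal.ofReal (s * (t ^ ((s : ℝ) - 1) * exp (-t ^ γ))) := by
    intro t ht
    have ht : 0 < t := ht
    rw [← ENNReal.ofReal_mul (by positivity), mul_assoc, ← rpow_natCast, Nat.cast_sub hs,
      Nat.cast_one]
  rw [setLIntegral_congr_fun measurableSet_Ioi hcongr, ← ofReal_integral_eq_lintegral_ofReal]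
  · rw [integral_const_mul, integral_rpow_mul_exp_neg_rpow hγ hs', sub_add_cancel]
  · simpa using (integrableOn_rpow_mul_exp_neg_mul_rpow hs' hγ one_pos).const_mul (s : ℝ)
  · filter_upwards [ae_restrict_mem measurableSet_Ioi] with t ht
    have : 0 < t := ht
    simp only [Pi.zero_apply]
    positivity

/-- The constant in the polar-coordinate formula for `pnorm γ` on the positive orthant. -/
noncomputable def polarConst (s : ℕ) (γ : ℝ) : ℝ :=
  Gamma (1 / γ) ^ s / (γ ^ (s - 1) * Gamma (s / γ))

lemma polarConst_pos {s : ℕ} (hs : 0 < s) {γ : ℝ} (hγ : 0 < γ) : 0 < polarConst s γ := by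
  have h1 : 0 < Gamma (1 / γ) := Gamma_pos_of_pos (by positivity)
  have h2 : 0 < Gamma (s / γ) := Gamma_pos_of_pos (by positivity)
  unfold polarConst; positivity

lemma volume_orthantBall_one {s : ℕ} (hs : 0 < s) {γ : ℝ} (hγ : 0 < γ) :
    volume (orthantBall s γ 1) = ENNReal.ofReal (polarConst s γ / s) := by
  have h1 : 0 < Gamma (1 / γ) := Gamma_pos_of_pos (by positivity)
  have h2 : 0 < Gamma (s / γ) := Gamma_pos_of_pos (by positivity)
  have hs' : (0 : ℝ) < s := by exact_mod_cast hs
  have key := lintegral_pnorm_eq_volume_mul hs hγ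
    (φ := fun t => ENNReal.ofReal (exp (-t ^ γ))) (by fun_prop)
  rw [lintegral_exp_neg_pnorm_rpow s hγ, lintegral_pow_mul_exp_neg_rpow hs hγ] at key
  have hpos : 0 < (s : ℝ) * (1 / γ * Gamma (s / γ)) := by positivity
  rw [mul_comm, eq_comm, ← ENNReal.eq_div_iff (ENNReal.ofReal_pos.2 hpos).ne' ENNReal.ofReal_ne_top,
    ← ENNReal.ofReal_div_of_pos hpos] at key
  rw [key, polarConst, Gamma_add_one (by positivity)]
  congr 1
  obtain ⟨k, rfl⟩ : ∃ k, s = k + 1 := ⟨s - 1, by omega⟩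
  simp only [Nat.add_sub_cancel]
  field_simp
  rw [div_pow]
  field_simp
  ring

/-- Polar coordinates for functions of `pnorm γ` on the positive orthant. -/
lemma lintegral_pnorm {s : ℕ} (hs : 0 < s) {γ : ℝ} (hγ : 0 < γ) {φ : ℝ → ℝ≥0∞}
    (hφ : Measurable φ) :
    ∫⁻ x in posOrthant s, φ (pnorm γ x) = ENNReal.ofReal (polarConst s γ) *
      ∫⁻ t in Ioi 0, ENNReal.ofReal (t ^ ((s : ℝ) - 1)) * φ t := by
  have hs' : (0 : ℝ) < s := by exact_mod_cast hs
  have hcongr : ∀ t ∈ Ioi (0 : ℝ), ENNReal.ofReal (s * t ^ (s - 1)) * φ t =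
      ENNReal.ofReal s * (ENNReal.ofReal (t ^ ((s : ℝ) - 1)) * φ t) := by
    intro t ht
    rw [ENNReal.ofReal_mul hs'.le, mul_assoc, ← rpow_natCast, Nat.cast_sub hs, Nat.cast_one]
  rw [lintegral_pnorm_eq_volume_mul hs hγ hφ, volume_orthantBall_one hs hγ,
    setLIntegral_congr_fun measurableSet_Ioi hcongr, lintegral_const_mul _ (by fun_prop),
    ← mul_assoc, ← ENNReal.ofReal_mul (div_nonneg (polarConst_pos hs hγ).le hs'.le),
    div_mul_cancel₀ _ hs'.ne']

lemma cothR_sub_one {v : ℝ} (hv : 0 < v) :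
    cothR v - 1 = 2 * exp (-(2 * v)) / (1 - exp (-(2 * v))) := by
  have h1 : exp (-v) < exp v := exp_lt_exp.2 (by linarith)
  have h2 : exp (-(2 * v)) < 1 := Real.exp_lt_one_iff.2 (by linarith)
  have h3 : exp (-v) = exp v * exp (-(2 * v)) := by rw [← exp_add]; ring_nf
  have h4 : exp v - exp (-v) ≠ 0 := by linarith
  have h5 : 1 - exp (-(2 * v)) ≠ 0 := by linarith
  unfold cothR
  rw [div_sub_one h4, div_eq_div_iff h4 h5, h3]
  ring

lemma cothR_sub_one_pos {v : ℝ} (hv : 0 < v) : 0 < cothR v - 1 := by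
  have h2 : exp (-(2 * v)) < 1 := Real.exp_lt_one_iff.2 (by linarith)
  rw [cothR_sub_one hv]
  exact div_pos (by positivity) (by linarith)

@[fun_prop]
lemma measurable_cothR : Measurable cothR := by
  unfold cothR; fun_prop

lemma hasSum_cothR_sub_one {v : ℝ} (hv : 0 < v) :
    HasSum (fun k : ℕ+ => 2 * exp (-(2 * k * v))) (cothR v - 1) := by
  rw [cothR_sub_one hv, ← Equiv.pnatEquivNat.symm.hasSum_iff]
  have h := (hasSum_geometric_of_lt_one (exp_pos (-(2 * v))).le
    (Real.exp_lt_one_iff.2 (by linarith))).mul_left (2 * exp (-(2 * v)))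
  have heq : (fun k : ℕ+ => 2 * exp (-(2 * k * v))) ∘ Equiv.pnatEquivNat.symm =
      fun k => 2 * exp (-(2 * v)) * exp (-(2 * v)) ^ k := by
    ext k
    simp only [Function.comp_apply, Equiv.pnatEquivNat_symm_apply, Nat.succPNat_coe,
      Nat.succ_eq_add_one, Nat.cast_add, Nat.cast_one]
    rw [← exp_nat_mul, mul_assoc 2 (rexp _), ← exp_add]
    ring_nf
  rw [div_eq_mul_inv, heq]
  exact h

/-- The Mellin transform of `coth - 1`. -/
noncomputable def mellinCoth (σ : ℝ) : ℝ := Gamma σ / 2 ^ (σ - 1) * zetaR σ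

lemma summable_pnat_rpow_neg {σ : ℝ} (hσ : 1 < σ) : Summable fun k : ℕ+ => (k : ℝ) ^ (-σ) :=
  (Real.summable_nat_rpow.2 (by linarith : -σ < -1)).comp_injective PNat.coe_injective

lemma zetaR_pos {σ : ℝ} (hσ : 1 < σ) : 0 < zetaR σ :=
  (summable_pnat_rpow_neg hσ).tsum_pos (fun _ => by positivity) 1 (by simp)

lemma mellinCoth_pos {σ : ℝ} (hσ : 1 < σ) : 0 < mellinCoth σ := by
  have h1 : 0 < Gamma σ := Gamma_pos_of_pos (by linarith)
  have h2 := zetaR_pos hσ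
  unfold mellinCoth; positivity

lemma lintegral_rpow_mul_exp_neg_mul {σ c : ℝ} (hσ : 0 < σ) (hc : 0 < c) :
    ∫⁻ r in Ioi (0 : ℝ), ENNReal.ofReal (r ^ (σ - 1) * exp (-(c * r))) =
      ENNReal.ofReal ((1 / c) ^ σ * Gamma σ) := by
  rw [← ofReal_integral_eq_lintegral_ofReal, integral_rpow_mul_exp_neg_mul_Ioi hσ hc]
  · simpa [IntegrableOn] using
      integrableOn_rpow_mul_exp_neg_mul_rpow (s := σ - 1) (by linarith) one_pos hc
  · filter_upwards [ae_restrict_mem measurableSet_Ioi] with t ht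
    have : 0 < t := ht
    simp only [Pi.zero_apply]
    positivity

lemma lintegral_rpow_mul_cothR_sub_one {σ : ℝ} (hσ : 1 < σ) :
    ∫⁻ r in Ioi (0 : ℝ), ENNReal.ofReal (r ^ (σ - 1)) * ENNReal.ofReal (cothR r - 1) =
      ENNReal.ofReal (mellinCoth σ) := by
  have hcongr : ∀ r ∈ Ioi (0 : ℝ), ENNReal.ofReal (r ^ (σ - 1)) * ENNReal.ofReal (cothR r - 1) =
      ∑' k : ℕ+, 2 * ENNReal.ofReal (r ^ (σ - 1) * exp (-(2 * k * r))) := by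
    intro r hr
    have hr : 0 < r := hr
    have hs := hasSum_cothR_sub_one hr
    rw [← hs.tsum_eq, ENNReal.ofReal_tsum_of_nonneg (fun _ => by positivity) hs.summable,
      ← ENNReal.tsum_mul_left]
    congr 1 with k
    rw [ENNReal.ofReal_mul (by positivity), ENNReal.ofReal_mul (by positivity)]
    simp only [ENNReal.ofReal_ofNat]
    ring
  have hG : 0 < Gamma σ := Gamma_pos_of_pos (by linarith)
  have hterm : ∀ k : ℕ+, ∫⁻ r in Ioi (0 : ℝ),
      2 * ENNReal.ofReal (r ^ (σ - 1) * exp (-(2 * k * r))) =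
        ENNReal.ofReal (Gamma σ / 2 ^ (σ - 1) * (k : ℝ) ^ (-σ)) := by
    intro k
    have hk : (0 : ℝ) < k := by exact_mod_cast k.pos
    rw [lintegral_const_mul _ (by fun_prop),
      lintegral_rpow_mul_exp_neg_mul (by linarith) (by positivity),
      ← ENNReal.ofReal_ofNat, ← ENNReal.ofReal_mul (by norm_num)]
    congr 1
    rw [one_div, inv_rpow (by positivity), mul_rpow (by norm_num) hk.le, rpow_neg hk.le,
      rpow_sub_one (by norm_num)]
    field_simp
  rw [setLIntegral_congr_fun measurableSet_Ioi hcongr, lintegral_tsum (fun _ => by fun_prop)]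
  simp_rw [hterm]
  rw [← ENNReal.ofReal_tsum_of_nonneg (fun _ => by positivity)
    ((summable_pnat_rpow_neg hσ).mul_left _), tsum_mul_left]
  rfl

lemma lintegral_Ioi_comp_div {σ t : ℝ} (ht : 0 < t) {g : ℝ → ℝ≥0∞} (hg : Measurable g) :
    ∫⁻ r in Ioi (0 : ℝ), ENNReal.ofReal (r ^ (σ - 1)) * g (r / t) =
      ENNReal.ofReal (t ^ σ) * ∫⁻ r in Ioi (0 : ℝ), ENNReal.ofReal (r ^ (σ - 1)) * g r := by
  have himg : (fun r => t * r) '' Ioi (0 : ℝ) = Ioi 0 := by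
    rw [image_mul_left_Ioi ht, mul_zero]
  have h := lintegral_image_eq_lintegral_abs_deriv_mul (measurableSet_Ioi (a := (0 : ℝ)))
    (f := fun r => t * r) (f' := fun _ => t)
    (fun x _ => by simpa using ((hasDerivAt_id x).const_mul t).hasDerivWithinAt)
    (mul_right_injective₀ ht.ne').injOn (fun r => ENNReal.ofReal (r ^ (σ - 1)) * g (r / t))
  rw [himg] at h
  rw [h, ← lintegral_const_mul _ (by fun_prop)]
  refine setLIntegral_congr_fun measurableSet_Ioi fun r hr => ?_
  have hr : 0 < r := hr
  rw [mul_div_cancel_left₀ _ ht.ne', ← mul_assoc, ← mul_assoc, ← ENNReal.ofReal_mul (by positivity),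
    ← ENNReal.ofReal_mul (by positivity), abs_of_pos ht, mul_rpow ht.le hr.le,
    rpow_sub_one ht.ne']
  field_simp

lemma lintegral_Ioi_comp_const_div {σ t : ℝ} (ht : 0 < t) {g : ℝ → ℝ≥0∞} (hg : Measurable g) :
    ∫⁻ r in Ioi (0 : ℝ), ENNReal.ofReal (r ^ (-σ - 1)) * g (t / r) =
      ENNReal.ofReal (t ^ (-σ)) * ∫⁻ r in Ioi (0 : ℝ), ENNReal.ofReal (r ^ (σ - 1)) * g r := by
  have himg : (fun r => t * r⁻¹) '' Ioi (0 : ℝ) = Ioi 0 := by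
    ext y
    simp only [mem_image, mem_Ioi]
    constructor
    · rintro ⟨r, hr, rfl⟩; positivity
    · intro hy
      exact ⟨t * y⁻¹, by positivity, by field_simp⟩
  have h := lintegral_image_eq_lintegral_abs_deriv_mul (measurableSet_Ioi (a := (0 : ℝ)))
    (f := fun r => t * r⁻¹) (f' := fun r => t * -(r ^ 2)⁻¹)
    (fun x hx => ((hasDerivAt_inv (ne_of_gt hx)).const_mul t).hasDerivWithinAt)
    ((mul_right_injective₀ ht.ne').comp inv_injective).injOn
    (fun r => ENNReal.ofReal (r ^ (-σ - 1)) * g (t / r))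
  rw [himg] at h
  rw [h, ← lintegral_const_mul _ (by fun_prop)]
  refine setLIntegral_congr_fun measurableSet_Ioi fun r hr => ?_
  have hr : 0 < r := hr
  have hdiv : t / (t * r⁻¹) = r := by field_simp
  rw [hdiv, ← mul_assoc, ← mul_assoc, ← ENNReal.ofReal_mul (by positivity),
    ← ENNReal.ofReal_mul (by positivity), abs_mul, abs_neg, abs_of_pos ht, abs_of_pos (by positivity),
    mul_rpow ht.le (by positivity), inv_rpow hr.le, ← rpow_neg hr.le, rpow_sub_one ht.ne',
    neg_sub, sub_neg_eq_add, rpow_sub_one hr.ne', add_comm, rpow_add_one hr.ne']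
  field_simp

lemma lintegral_cothR_mul_pnorm_rpow {s : ℕ} (hs : 0 < s) {γ σ t : ℝ} (hγ : 0 < γ) (hσ : 1 < σ)
    (ht : 0 < t) :
    ∫⁻ x in posOrthant s, ENNReal.ofReal ((cothR (pnorm γ x / t) - 1) * pnorm γ x ^ (σ - s)) =
      ENNReal.ofReal (polarConst s γ * mellinCoth σ * t ^ σ) := by
  rw [lintegral_pnorm hs hγ
    (φ := fun r => ENNReal.ofReal ((cothR (r / t) - 1) * r ^ (σ - s))) (by fun_prop)]
  have hcongr : ∀ r ∈ Ioi (0 : ℝ),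
      ENNReal.ofReal (r ^ ((s : ℝ) - 1)) * ENNReal.ofReal ((cothR (r / t) - 1) * r ^ (σ - s)) =
        ENNReal.ofReal (r ^ (σ - 1)) * ENNReal.ofReal (cothR (r / t) - 1) := by
    intro r hr
    have hr : 0 < r := hr
    rw [← ENNReal.ofReal_mul (by positivity), ← ENNReal.ofReal_mul (by positivity), mul_left_comm,
      ← rpow_add hr, mul_comm]
    ring_nf
  rw [setLIntegral_congr_fun measurableSet_Ioi hcongr,
    lintegral_Ioi_comp_div ht (g := fun v => ENNReal.ofReal (cothR v - 1)) (by fun_prop),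
    lintegral_rpow_mul_cothR_sub_one hσ, ← ENNReal.ofReal_mul (by positivity),
    ← ENNReal.ofReal_mul (polarConst_pos hs hγ).le]
  ring_nf

lemma lintegral_cothR_const_div_mul_pnorm_rpow {s : ℕ} (hs : 0 < s) {γ σ t : ℝ} (hγ : 0 < γ)
    (hσ : 1 < σ) (ht : 0 < t) :
    ∫⁻ y in posOrthant s, ENNReal.ofReal (pnorm γ y ^ (-σ - s) * (cothR (t / pnorm γ y) - 1)) =
      ENNReal.ofReal (polarConst s γ * mellinCoth σ * t ^ (-σ)) := by
  rw [lintegral_pnorm hs hγ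
    (φ := fun r => ENNReal.ofReal (r ^ (-σ - s) * (cothR (t / r) - 1))) (by fun_prop)]
  have hcongr : ∀ r ∈ Ioi (0 : ℝ),
      ENNReal.ofReal (r ^ ((s : ℝ) - 1)) * ENNReal.ofReal (r ^ (-σ - s) * (cothR (t / r) - 1)) =
        ENNReal.ofReal (r ^ (-σ - 1)) * ENNReal.ofReal (cothR (t / r) - 1) := by
    intro r hr
    have hr : 0 < r := hr
    rw [← ENNReal.ofReal_mul (by positivity), ← ENNReal.ofReal_mul (by positivity), ← mul_assoc,
      ← rpow_add hr]
    ring_nf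
  rw [setLIntegral_congr_fun measurableSet_Ioi hcongr,
    lintegral_Ioi_comp_const_div ht (g := fun v => ENNReal.ofReal (cothR v - 1)) (by fun_prop),
    lintegral_rpow_mul_cothR_sub_one hσ, ← ENNReal.ofReal_mul (by positivity),
    ← ENNReal.ofReal_mul (polarConst_pos hs hγ).le]
  ring_nf

lemma not_integrableOn_pnorm_rpow_neg {s : ℕ} (hs : 0 < s) {γ : ℝ} (hγ : 0 < γ) :
    ¬ IntegrableOn (fun x : Fin s → ℝ => pnorm γ x ^ (-(s : ℝ))) (posOrthant s) := by
  intro h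
  have h1 := h.lintegral_lt_top
  rw [lintegral_pnorm hs hγ (φ := fun r => ENNReal.ofReal (r ^ (-(s : ℝ)))) (by fun_prop)] at h1
  have hcongr : ∀ r ∈ Ioi (0 : ℝ),
      ENNReal.ofReal (r ^ ((s : ℝ) - 1)) * ENNReal.ofReal (r ^ (-(s : ℝ))) =
        ENNReal.ofReal (r⁻¹) := by
    intro r hr
    have hr : 0 < r := hr
    rw [← ENNReal.ofReal_mul (by positivity), ← rpow_add hr, ← rpow_neg_one]
    ring_nf
  rw [setLIntegral_congr_fun measurableSet_Ioi hcongr] at h1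
  refine not_integrableOn_Ioi_inv (a := (0 : ℝ)) ⟨by fun_prop, ?_⟩
  rw [hasFiniteIntegral_iff_ofReal]
  · refine ENNReal.lt_top_of_mul_ne_top_right h1.ne ?_
    exact (ENNReal.ofReal_pos.2 (polarConst_pos hs hγ)).ne'
  · filter_upwards [ae_restrict_mem measurableSet_Ioi] with t ht
    exact inv_nonneg.2 (le_of_lt ht)

lemma Real.rpow_inv_mul_rpow_inv_le {p q a b : ℝ} (hpq : p.HolderConjugate q)
    (ha : 0 ≤ a) (hb : 0 ≤ b) : a ^ p⁻¹ * b ^ q⁻¹ ≤ p⁻¹ * a + q⁻¹ * b :=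
  geom_mean_le_arith_mean2_weighted hpq.inv_nonneg hpq.symm.inv_nonneg ha hb
    hpq.inv_add_inv_eq_one

/-- **Hölder's inequality**, strict when the two functions are not proportional. -/
lemma integral_rpow_mul_rpow_lt {X : Type*} [MeasurableSpace X] {μ : Measure X} {φ ψ : X → ℝ}
    {p q : ℝ} (hpq : p.HolderConjugate q) (hφ0 : 0 ≤ᵐ[μ] φ) (hψ0 : 0 ≤ᵐ[μ] ψ)
    (hφ : Integrable φ μ) (hψ : Integrable ψ μ) (hψpos : 0 < ∫ x, ψ x ∂μ)
    (hne : ∀ c : ℝ, ¬ φ =ᵐ[μ] fun x => c * ψ x) :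
    ∫ x, φ x ^ p⁻¹ * ψ x ^ q⁻¹ ∂μ < (∫ x, φ x ∂μ) ^ p⁻¹ * (∫ x, ψ x ∂μ) ^ q⁻¹ := by
  set A := ∫ x, φ x ∂μ with hA
  set B := ∫ x, ψ x ∂μ with hB
  have hApos : 0 < A := by
    refine lt_of_le_of_ne (integral_nonneg_of_ae hφ0) fun h => hne 0 ?_
    simpa using! (integral_eq_zero_iff_of_nonneg_ae hφ0 hφ).1 h.symm
  set G : X → ℝ := fun x => (φ x / A) ^ p⁻¹ * (ψ x / B) ^ q⁻¹ with hG
  set M : X → ℝ := fun x => p⁻¹ * (φ x / A) + q⁻¹ * (ψ x / B) with hM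
  have hG0 : 0 ≤ᵐ[μ] G := by
    filter_upwards [hφ0, hψ0] with x h1 h2
    have h1 : 0 ≤ φ x := h1
    have h2 : 0 ≤ ψ x := h2
    simp only [hG, Pi.zero_apply]; positivity
  have hGM : G ≤ᵐ[μ] M := by
    filter_upwards [hφ0, hψ0] with x h1 h2
    exact rpow_inv_mul_rpow_inv_le hpq (div_nonneg h1 hApos.le) (div_nonneg h2 hψpos.le)
  have hMint : Integrable M μ := ((hφ.div_const A).const_mul _).add ((hψ.div_const B).const_mul _)
  have hGint : Integrable G μ := by
    refine hMint.mono' ?_ ?_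
    · exact (((hφ.1.aemeasurable.div_const A).pow_const _).mul
        ((hψ.1.aemeasurable.div_const B).pow_const _)).aestronglyMeasurable
    · filter_upwards [hG0, hGM] with x h1 h2
      rwa [norm_of_nonneg h1]
  have hMval : ∫ x, M x ∂μ = 1 := by
    simp only [hM]
    rw [integral_add ((hφ.div_const A).const_mul _) ((hψ.div_const B).const_mul _),
      integral_const_mul, integral_const_mul, integral_div, integral_div, ← hA, ← hB,
      div_self hApos.ne', div_self hψpos.ne', mul_one, mul_one, hpq.inv_add_inv_eq_one]
  have hlt : ∫ x, G x ∂μ < 1 := by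
    rw [← hMval]
    refine lt_of_le_of_ne (integral_mono_ae hGint hMint hGM) fun h => hne (A / B) ?_
    have heq := (integral_eq_iff_of_ae_le hGint hMint hGM).1 h
    filter_upwards [heq, hφ0, hψ0] with x hx h1 h2
    have : φ x / A = ψ x / B :=
      (geom_mean_eq_arith_mean2_weighted_iff_of_pos hpq.inv_pos hpq.symm.inv_pos
        (div_nonneg h1 hApos.le) (div_nonneg h2 hψpos.le) hpq.inv_add_inv_eq_one).1 hx
    field_simp at this ⊢
    linarith
  have hfactor : ∫ x, φ x ^ p⁻¹ * ψ x ^ q⁻¹ ∂μ = A ^ p⁻¹ * B ^ q⁻¹ * ∫ x, G x ∂μ := by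
    rw [← integral_const_mul]
    refine integral_congr_ae ?_
    filter_upwards [hφ0, hψ0] with x h1 h2
    have hA' : A ^ p⁻¹ ≠ 0 := by positivity
    have hB' : B ^ q⁻¹ ≠ 0 := by positivity
    simp only [hG]
    rw [div_rpow h1 hApos.le, div_rpow h2 hψpos.le]
    field_simp
  rw [hfactor]
  exact mul_lt_of_lt_one_right (by positivity) hlt

section Kernel

variable {m : ℕ} {α σ p q : ℝ} {f : (Fin m → ℝ) → ℝ}

/-- The weighted kernel integral bounding the `p`-th power of the coth transform at scale `t`. -/
noncomputable def weightedCothIntegral (α σ p : ℝ) (f : (Fin m → ℝ) → ℝ) (t : ℝ) : ℝ≥0∞ :=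
  ∫⁻ x in posOrthant m,
    ENNReal.ofReal ((cothR (pnorm α x / t) - 1) * (f x ^ p * pnorm α x ^ ((m - σ) * (p - 1))))

lemma not_ae_proportional (hm : 0 < m) (hα : 0 < α)
    (hfi : IntegrableOn (fun x => pnorm α x ^ (p * (m - σ) - m) * f x ^ p) (posOrthant m))
    (hfpos : 0 < ∫ x in posOrthant m, pnorm α x ^ (p * (m - σ) - m) * f x ^ p)
    {t : ℝ} (ht : 0 < t) (c : ℝ) :
    ¬ (fun x => (cothR (pnorm α x / t) - 1) * (f x ^ p * pnorm α x ^ ((m - σ) * (p - 1))))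
      =ᵐ[volume.restrict (posOrthant m)]
        fun x => c * ((cothR (pnorm α x / t) - 1) * pnorm α x ^ (σ - m)) := by
  intro h
  have hW : (fun x => pnorm α x ^ (p * (m - σ) - m) * f x ^ p)
      =ᵐ[volume.restrict (posOrthant m)] fun x => c * pnorm α x ^ (-(m : ℝ)) := by
    filter_upwards [h, ae_restrict_mem (measurableSet_posOrthant m)] with x hx hxS
    have hr := pnorm_pos hm α hxS
    have hk := cothR_sub_one_pos (div_pos hr ht)
    have h1 : f x ^ p * pnorm α x ^ ((m - σ) * (p - 1)) = c * pnorm α x ^ (σ - m) :=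
      mul_left_cancel₀ hk.ne' (by linarith)
    have e1 : pnorm α x ^ (p * (m - σ) - m) =
        pnorm α x ^ ((m - σ) * (p - 1)) * pnorm α x ^ (-σ) := by
      rw [← rpow_add hr]; ring_nf
    have e2 : pnorm α x ^ (-(m : ℝ)) = pnorm α x ^ (σ - m) * pnorm α x ^ (-σ) := by
      rw [← rpow_add hr]; ring_nf
    rw [e1, e2, ← mul_assoc, ← h1]
    ring
  rcases eq_or_ne c 0 with rfl | hc
  · rw [integral_congr_ae hW] at hfpos
    simp at hfpos
  · refine not_integrableOn_pnorm_rpow_neg hm hα ?_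
    have := (hfi.congr hW).const_mul c⁻¹
    simpa [inv_mul_cancel_left₀ hc, IntegrableOn] using this

lemma coth_transform_rpow_lt (hm : 0 < m) (hα : 0 < α) (hσ : 1 < σ)
    (hpq : p.HolderConjugate q) (hf : Measurable f) (hf0 : ∀ x, 0 ≤ f x)
    (hfi : IntegrableOn (fun x => pnorm α x ^ (p * (m - σ) - m) * f x ^ p) (posOrthant m))
    (hfpos : 0 < ∫ x in posOrthant m, pnorm α x ^ (p * (m - σ) - m) * f x ^ p)
    {t : ℝ} (ht : 0 < t) (hfin : weightedCothIntegral α σ p f t < ∞) :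
    (∫ x in posOrthant m, (cothR (pnorm α x / t) - 1) * f x) ^ p <
      (weightedCothIntegral α σ p f t).toReal *
        (polarConst m α * mellinCoth σ * t ^ σ) ^ (p - 1) := by
  set φ : (Fin m → ℝ) → ℝ := fun x =>
    (cothR (pnorm α x / t) - 1) * (f x ^ p * pnorm α x ^ ((m - σ) * (p - 1))) with hφdef
  set ψ : (Fin m → ℝ) → ℝ := fun x =>
    (cothR (pnorm α x / t) - 1) * pnorm α x ^ (σ - m) with hψdef
  have hp0 := hpq.pos
  have hmem := ae_restrict_mem (μ := volume) (measurableSet_posOrthant m)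
  have hk : ∀ᵐ x ∂volume.restrict (posOrthant m), 0 < cothR (pnorm α x / t) - 1 := by
    filter_upwards [hmem] with x hx
    exact cothR_sub_one_pos (div_pos (pnorm_pos hm α hx) ht)
  have hφ0 : 0 ≤ᵐ[volume.restrict (posOrthant m)] φ := by
    filter_upwards [hk] with x hx
    have := hf0 x
    have := pnorm_nonneg α x
    simp only [hφdef, Pi.zero_apply]
    positivity
  have hψ0 : 0 ≤ᵐ[volume.restrict (posOrthant m)] ψ := by
    filter_upwards [hk] with x hx
    have := pnorm_nonneg α x
    simp only [hψdef, Pi.zero_apply]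
    positivity
  have hφm : Measurable φ := by fun_prop
  have hψm : Measurable ψ := by fun_prop
  have hφi : Integrable φ (volume.restrict (posOrthant m)) :=
    ⟨hφm.aestronglyMeasurable, (hasFiniteIntegral_iff_ofReal hφ0).2 hfin⟩
  have hψl := lintegral_cothR_mul_pnorm_rpow hm hα hσ ht
  have hψi : Integrable ψ (volume.restrict (posOrthant m)) :=
    ⟨hψm.aestronglyMeasurable, (hasFiniteIntegral_iff_ofReal hψ0).2
      (hψl.trans_lt ENNReal.ofReal_lt_top)⟩
  have hBpos : 0 < polarConst m α * mellinCoth σ * t ^ σ := by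
    have := polarConst_pos hm hα
    have := mellinCoth_pos hσ
    positivity
  have hψint : ∫ x in posOrthant m, ψ x = polarConst m α * mellinCoth σ * t ^ σ := by
    rw [integral_eq_lintegral_of_nonneg_ae hψ0 hψm.aestronglyMeasurable, hψl,
      ENNReal.toReal_ofReal hBpos.le]
  have hφint : ∫ x in posOrthant m, φ x = (weightedCothIntegral α σ p f t).toReal :=
    integral_eq_lintegral_of_nonneg_ae hφ0 hφm.aestronglyMeasurable
  have hlt := integral_rpow_mul_rpow_lt hpq hφ0 hψ0 hφi hψi (hψint ▸ hBpos)
    (not_ae_proportional hm hα hfi hfpos ht)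
  have hpq1 : (p - 1) * p⁻¹ = q⁻¹ := by
    have := hpq.inv_add_inv_eq_one
    have h2 : p * p⁻¹ = 1 := mul_inv_cancel₀ hp0.ne'
    linarith
  have hker : ∫ x in posOrthant m, φ x ^ p⁻¹ * ψ x ^ q⁻¹ =
      ∫ x in posOrthant m, (cothR (pnorm α x / t) - 1) * f x := by
    refine integral_congr_ae ?_
    filter_upwards [hk, hmem] with x hx hxS
    have hr := pnorm_pos hm α hxS
    simp only [hφdef, hψdef]
    rw [mul_rpow hx.le (by have := hf0 x; positivity), mul_rpow (by have := hf0 x; positivity)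
      (by positivity), mul_rpow hx.le (by positivity), ← rpow_mul (hf0 x),
      mul_inv_cancel₀ hp0.ne', rpow_one, ← rpow_mul hr.le, ← rpow_mul hr.le, mul_assoc (_ - _), hpq1]
    have e1 : (cothR (pnorm α x / t) - 1) ^ p⁻¹ * (cothR (pnorm α x / t) - 1) ^ q⁻¹ =
        cothR (pnorm α x / t) - 1 := by
      rw [← rpow_add hx, hpq.inv_add_inv_eq_one, rpow_one]
    have e2 : pnorm α x ^ ((m - σ) * q⁻¹) * pnorm α x ^ ((σ - m) * q⁻¹) = 1 := by
      rw [← rpow_add hr, ← add_mul]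
      simp
    linear_combination f x * (cothR (pnorm α x / t) - 1) ^ p⁻¹ *
      (cothR (pnorm α x / t) - 1) ^ q⁻¹ * e2 + f x * e1
  rw [hker, hφint, hψint] at hlt
  have hnn : 0 ≤ ∫ x in posOrthant m, (cothR (pnorm α x / t) - 1) * f x :=
    integral_nonneg_of_ae (by
      filter_upwards [hk] with x hx
      exact mul_nonneg hx.le (hf0 x))
  refine (rpow_lt_rpow hnn hlt hp0).trans_eq ?_
  rw [mul_rpow (by positivity) (by positivity), ← rpow_mul ENNReal.toReal_nonneg,
    ← rpow_mul hBpos.le, inv_mul_cancel₀ hp0.ne', rpow_one, ← hpq1, mul_assoc (p - 1),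
    inv_mul_cancel₀ hp0.ne', mul_one]

lemma measurable_weightedCothIntegral (hf : Measurable f) :
    Measurable (weightedCothIntegral α σ p f) := by
  unfold weightedCothIntegral
  exact Measurable.lintegral_prod_right (by fun_prop)

lemma lintegral_weightedCothIntegral {n : ℕ} {β : ℝ} (hm : 0 < m) (hn : 0 < n) (hβ : 0 < β)
    (hσ : 1 < σ) (hf : Measurable f) (hf0 : ∀ x, 0 ≤ f x) :
    ∫⁻ y in posOrthant n, ENNReal.ofReal (pnorm β y ^ (-σ - n)) *
        weightedCothIntegral α σ p f (pnorm β y) =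
      ENNReal.ofReal (polarConst n β * mellinCoth σ) *
        ∫⁻ x in posOrthant m, ENNReal.ofReal (pnorm α x ^ (p * (m - σ) - m) * f x ^ p) := by
  unfold weightedCothIntegral
  simp_rw [← lintegral_const_mul' _ _ ENNReal.ofReal_ne_top]
  rw [lintegral_lintegral_swap (by unfold Function.uncurry; fun_prop)]
  refine setLIntegral_congr_fun (measurableSet_posOrthant m) fun x hx => ?_
  have hr := pnorm_pos hm α hx
  have hfx := hf0 x
  have hcongr : ∀ y ∈ posOrthant n, ENNReal.ofReal (pnorm β y ^ (-σ - n)) *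
      ENNReal.ofReal ((cothR (pnorm α x / pnorm β y) - 1) *
        (f x ^ p * pnorm α x ^ ((m - σ) * (p - 1)))) =
      ENNReal.ofReal (f x ^ p * pnorm α x ^ ((m - σ) * (p - 1))) *
        ENNReal.ofReal (pnorm β y ^ (-σ - n) * (cothR (pnorm α x / pnorm β y) - 1)) := by
    intro y hy
    have := pnorm_nonneg β y
    rw [← ENNReal.ofReal_mul (by positivity), ← ENNReal.ofReal_mul (by positivity)]
    ring_nf
  have hC := polarConst_pos hn hβ
  have hκ := mellinCoth_pos hσ
  have e1 : pnorm α x ^ (p * (m - σ) - m) =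
      pnorm α x ^ ((m - σ) * (p - 1)) * pnorm α x ^ (-σ) := by
    rw [← rpow_add hr]; ring_nf
  rw [setLIntegral_congr_fun (measurableSet_posOrthant n) hcongr,
    lintegral_const_mul' _ _ ENNReal.ofReal_ne_top,
    lintegral_cothR_const_div_mul_pnorm_rpow hn hβ hσ hr, ← ENNReal.ofReal_mul (by positivity),
    ← ENNReal.ofReal_mul (by positivity), e1]
  ring_nf

end Kernel

/-- Two functions with a strict a.e. inequality have strictly ordered Bochner integrals, even when
the smaller one is not integrable, provided the larger integral is positive. -/
lemma integral_lt_integral_of_ae_lt {X : Type*} [MeasurableSpace X] {μ : Measure X} {L R : X → ℝ}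
    (hR : Integrable R μ) (hRpos : 0 < ∫ x, R x ∂μ) (hlt : ∀ᵐ x ∂μ, L x < R x) :
    ∫ x, L x ∂μ < ∫ x, R x ∂μ := by
  by_cases hL : Integrable L μ
  · have hle : L ≤ᵐ[μ] R := hlt.mono fun _ h => h.le
    refine lt_of_le_of_ne (integral_mono_ae hL hR hle) fun h => ?_
    have heq := (integral_eq_iff_of_ae_le hL hR hle).1 h
    have hfalse : ∀ᵐ _ ∂μ, False := by
      filter_upwards [heq, hlt] with x h1 h2
      exact h2.ne h1
    rw [Filter.eventually_false_iff_eq_bot, ae_eq_bot] at hfalse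
    simp [hfalse] at hRpos
  · rwa [integral_undef hL]

theorem stmt_15 (m n : ℕ) (hm : 0 < m) (hn : 0 < n) (α β σ p q : ℝ)
    (hα : 0 < α) (hβ : 0 < β) (hσ : 1 < σ) (hp : 1 < p) (hpq : 1 / p + 1 / q = 1)
    (f : (Fin m → ℝ) → ℝ) (hf : Measurable f) (hf0 : ∀ x, 0 ≤ f x)
    (hfi : IntegrableOn (fun x => pnorm α x ^ (p * (m - σ) - m) * f x ^ p)
      {x : Fin m → ℝ | ∀ i, 0 < x i} volume)
    (hfpos : 0 < ∫ x in {x : Fin m → ℝ | ∀ i, 0 < x i},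
      pnorm α x ^ (p * (m - σ) - m) * f x ^ p) :
    (∫ y in {y : Fin n → ℝ | ∀ i, 0 < y i}, pnorm β y ^ (-p * σ - n) *
        (∫ x in {x : Fin m → ℝ | ∀ i, 0 < x i},
          (cothR (pnorm α x / pnorm β y) - 1) * f x) ^ p) ^ (1 / p) <
      (Real.Gamma (1 / β) ^ n / (β ^ (n - 1) * Real.Gamma (n / β))) ^ (1 / p) *
        (Real.Gamma (1 / α) ^ m / (α ^ (m - 1) * Real.Gamma (m / α))) ^ (1 / q) *
        (Real.Gamma σ / 2 ^ (σ - 1)) * zetaR σ *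
        (∫ x in {x : Fin m → ℝ | ∀ i, 0 < x i},
          pnorm α x ^ (p * (m - σ) - m) * f x ^ p) ^ (1 / p) := by
  have hpq' : p.HolderConjugate q := holderConjugate_iff.2 ⟨hp, by simpa using hpq⟩
  have hp0 : 0 < p := by linarith
  set I := ∫ x in posOrthant m, pnorm α x ^ (p * (m - σ) - m) * f x ^ p with hI
  have hCm := polarConst_pos hm hα
  have hCn := polarConst_pos hn hβ
  have hκ := mellinCoth_pos hσ
  set H : (Fin n → ℝ) → ℝ≥0∞ := fun y => ENNReal.ofReal (pnorm β y ^ (-σ - n)) *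
    weightedCothIntegral α σ p f (pnorm β y) with hH
  have hHm : Measurable H :=
    Measurable.mul (by fun_prop) ((measurable_weightedCothIntegral hf).comp (measurable_pnorm β))
  have hHint : ∫⁻ y in posOrthant n, H y =
      ENNReal.ofReal (polarConst n β * mellinCoth σ * I) := by
    rw [hH, lintegral_weightedCothIntegral hm hn hβ hσ hf hf0,
      ← ofReal_integral_eq_lintegral_ofReal hfi (Filter.Eventually.of_forall fun x => by
        have := pnorm_nonneg α x
        have := hf0 x
        simp only [Pi.zero_apply]; positivity),
      ← ENNReal.ofReal_mul (by positivity)]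
  have hHfin : ∫⁻ y in posOrthant n, H y ≠ ∞ := hHint ▸ ENNReal.ofReal_ne_top
  have hHlt := ae_lt_top hHm hHfin
  set R : (Fin n → ℝ) → ℝ := fun y => (polarConst m α * mellinCoth σ) ^ (p - 1) * (H y).toReal
    with hR
  have hRi : Integrable R (volume.restrict (posOrthant n)) :=
    (integrable_toReal_of_lintegral_ne_top hHm.aemeasurable hHfin).const_mul _
  have hRint : ∫ y in posOrthant n, R y =
      (polarConst m α * mellinCoth σ) ^ (p - 1) * (polarConst n β * mellinCoth σ * I) := by
    rw [hR, integral_const_mul, integral_toReal hHm.aemeasurable hHlt, hHint,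
      ENNReal.toReal_ofReal (by positivity)]
  have hlt := integral_lt_integral_of_ae_lt (μ := volume.restrict (posOrthant n))
    (L := fun y => pnorm β y ^ (-p * σ - n) *
      (∫ x in posOrthant m, (cothR (pnorm α x / pnorm β y) - 1) * f x) ^ p) hRi
    (by rw [hRint]; positivity) (by
      filter_upwards [hHlt, ae_restrict_mem (measurableSet_posOrthant n)] with y hy hyS
      have ht := pnorm_pos hn β hyS
      have hw : 0 < pnorm β y ^ (-σ - n) := by positivity
      have hfin := ENNReal.lt_top_of_mul_ne_top_right hy.ne (ENNReal.ofReal_pos.2 hw).ne'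
      have h := mul_lt_mul_of_pos_left
        (coth_transform_rpow_lt hm hα hσ hpq' hf hf0 hfi hfpos ht hfin)
        (rpow_pos_of_pos ht (-p * σ - n))
      refine h.trans_eq ?_
      have e : pnorm β y ^ (-σ - n) = pnorm β y ^ (-p * σ - n) * pnorm β y ^ (σ * (p - 1)) := by
        rw [← rpow_add ht]; ring_nf
      simp only [hR, hH]
      rw [ENNReal.toReal_mul, ENNReal.toReal_ofReal hw.le, mul_rpow (by positivity) (by positivity),
        ← rpow_mul ht.le, e]
      ring)
  have hL0 : 0 ≤ ∫ y in posOrthant n, pnorm β y ^ (-p * σ - n) *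
      (∫ x in posOrthant m, (cothR (pnorm α x / pnorm β y) - 1) * f x) ^ p := by
    refine setIntegral_nonneg (measurableSet_posOrthant n) fun y hy => ?_
    refine mul_nonneg (rpow_nonneg (pnorm_nonneg _ _) _) (rpow_nonneg ?_ _)
    exact setIntegral_nonneg (measurableSet_posOrthant m) fun x hx => mul_nonneg
      (cothR_sub_one_pos (div_pos (pnorm_pos hm α hx) (pnorm_pos hn β hy))).le (hf0 x)
  refine (rpow_lt_rpow hL0 hlt (by positivity : 0 < 1 / p)).trans_eq ?_
  have hpq1 : (p - 1) * (1 / p) = 1 / q := by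
    have : p * (1 / p) = 1 := mul_one_div_cancel hp0.ne'
    linarith
  have hκ1 : mellinCoth σ ^ (1 / q) * mellinCoth σ ^ (1 / p) = mellinCoth σ := by
    rw [← rpow_add hκ, add_comm, hpq, rpow_one]
  rw [hRint, mul_rpow (by positivity) (by positivity), ← rpow_mul (by positivity), hpq1,
    mul_rpow hCm.le hκ.le, mul_rpow (by positivity) hfpos.le, mul_rpow hCn.le hκ.le]
  calc _ = polarConst n β ^ (1 / p) * polarConst m α ^ (1 / q) *
        (mellinCoth σ ^ (1 / q) * mellinCoth σ ^ (1 / p)) * I ^ (1 / p) := by ring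
    _ = _ := by
      rw [hκ1]
      simp only [polarConst, mellinCoth]
      ring
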